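/- arXiv:1512.06040 — 2 statements merged into one kernel-verified Lean document; each statement's English description precedes it below -/
import Mathlib

section
/- Let R, R' be commutative Noetherian rings and f : R → R' a ring homomorphism. Let I be a radical ideal of R with minimal primary decomposition I = ⋂_{k=1}^s 𝔭_k into prime ideals. If the ideal generated by f(I) in R' is radical, then the ideal generated by f(I) equals the intersection of the ideals generated by the f(𝔭_k). -/
/-- if `I = ⋂ 𝔭_k` is a minimal prime decomposition of a radical ideal of a
Noetherian ring `R` and the image ideal `f(I)R'` is radical, then
`f(I)R' = ⋂ (f(𝔭_k)R')`. -/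
theorem map_radical_ideal_eq_inf_map_primes
    {R R' : Type*} [CommRing R] [CommRing R'] [IsNoetherianRing R] [IsNoetherianRing R']
    (f : R →+* R') (I : Ideal R) (hI : I.IsRadical)
    (s : ℕ) (p : Fin s → Ideal R) (hprime : ∀ k, (p k).IsPrime)
    (hdec : I = ⨅ k, p k)
    (hmin : ∀ k : Fin s, ¬ (⨅ j ∈ Finset.univ.erase k, p j) ≤ p k)
    (hrad : (I.map f).IsRadical) :
    I.map f = ⨅ k, (p k).map f := by
  apply le_antisymm
  · refine le_iInf fun k => Ideal.map_mono ?_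
    rw [hdec]
    exact iInf_le _ k
  · intro x hx
    refine hrad ⟨s, ?_⟩
    have h1 : ∏ _k : Fin s, x ∈ ∏ k : Fin s, (p k).map f :=
      Ideal.prod_mem_prod fun k _ => (Ideal.mem_iInf.mp hx) k
    have h2 : ∏ k : Fin s, (p k).map f = (∏ k : Fin s, p k).map f :=
      (map_prod (Ideal.mapHom f) p Finset.univ).symm
    have h3 : ∏ k : Fin s, p k ≤ I := by
      rw [hdec]
      refine le_iInf fun k => ?_
      exact Ideal.prod_le_inf.trans (Finset.inf_le (Finset.mem_univ k))
    rw [h2] at h1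
    have h4 := Ideal.map_mono (f := f) h3 h1
    simpa using h4
end

section
/- Let I ⊆ S = k[x_1,…,x_n] be a monomial ideal admitting a minimal cellular free resolution F_•^X supported on a finite regular CW complex X with grading map ρ : X^{(*)} → ℕ^n. Then S/I is Cohen–Macaulay if and only if for every a ∈ ℤ^n and every i ≠ dim X, the cohomology H^i(C^•(X^{≥a})) vanishes, where X^{≥a} = {σ : ρ(σ) ≥ a} and C^•(X^{≥a}) is its cellular cochain complex over k. -/
open CategoryTheory CategoryTheory.Limits AlgebraicTopology Metric MvPolynomial

/-- A finite regular CW structure on a topological space `X`, together with an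
incidence function (including incidence with the empty cell). -/
structure FinRegCWI (X : Type) [TopologicalSpace X] where
  ι : Type
  [instFin : Fintype ι]
  dim : ι → ℕ
  cell : ι → Set X
  pairwiseDisjoint : Pairwise fun i j => Disjoint (cell i) (cell j)
  cover : ⋃ i, cell i = Set.univ
  char : ∀ i, ∃ f : (closedBall (0 : EuclideanSpace ℝ (Fin (dim i))) 1) ≃ₜ (closure (cell i)),
    (fun x => ((f x : X))) '' {x : closedBall (0 : EuclideanSpace ℝ (Fin (dim i))) 1 |
      ‖(x : EuclideanSpace ℝ (Fin (dim i)))‖ < 1} = cell i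
  closure_isUnion : ∀ i, ∃ s : Set ι, closure (cell i) = ⋃ j ∈ s, cell j
  inc : ι → ι → ℤ
  incEmpty : ι → ℤ
  inc_ne_zero_iff : ∀ σ τ, inc σ τ ≠ 0 ↔ (dim σ = dim τ + 1 ∧ cell τ ⊆ closure (cell σ))
  inc_pm : ∀ σ τ, inc σ τ = 0 ∨ inc σ τ = 1 ∨ inc σ τ = -1
  incEmpty_eq : ∀ v, incEmpty v = if dim v = 0 then 1 else 0
  inc_sq : ∀ σ υ, (∑ τ : ι, inc σ τ * inc τ υ) = 0
  inc_aug : ∀ σ, dim σ = 1 → (∑ τ : ι, inc σ τ * incEmpty τ) = 0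

attribute [instance] FinRegCWI.instFin

variable (k : Type) [Field k] {n : ℕ}

section Comb

variable {X : Type} [TopologicalSpace X] (cw : FinRegCWI X)

/-- The `i`-cells of a CW complex lying in a given collection `Y` of cells. -/
def cellsIn (Y : Set cw.ι) (i : ℕ) : Type := {τ : cw.ι // τ ∈ Y ∧ cw.dim τ = i}

noncomputable instance (Y : Set cw.ι) (i : ℕ) : Fintype (cellsIn cw Y i) := by
  unfold cellsIn; exact Fintype.ofFinite _

/-- The coboundary map of the cochain complex `C^•(Y)` with coefficients in `k`. -/
noncomputable def cdiff (Y : Set cw.ι) (i : ℕ) :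
    (cellsIn cw Y i → k) →ₗ[k] (cellsIn cw Y (i + 1) → k) :=
  LinearMap.pi fun τ' => ∑ τ : cellsIn cw Y i,
    ((cw.inc τ'.1 τ.1 : ℤ) : k) • LinearMap.proj τ

/-- The augmentation map `C^{-1} = k → C^0(Y)` (present when `∅` lies in the filter). -/
noncomputable def caug (Y : Set cw.ι) (b : Bool) : k →ₗ[k] (cellsIn cw Y 0 → k) :=
  if b then (LinearMap.pi fun v => LinearMap.toSpanSingleton k k ((cw.incEmpty v.1 : ℤ) : k))
  else 0

/-- `H^i(C^•(Y))` (with augmentation when `b = true`): `ker d^i / im d^{i-1}`. -/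
noncomputable def combH (Y : Set cw.ι) (b : Bool) : ℕ → ModuleCat k
  | 0 => ModuleCat.of k
      ((LinearMap.ker (cdiff k cw Y 0)) ⧸
        (Submodule.comap (LinearMap.ker (cdiff k cw Y 0)).subtype
          (LinearMap.range (caug k cw Y b))))
  | (j + 1) => ModuleCat.of k
      ((LinearMap.ker (cdiff k cw Y (j + 1))) ⧸
        (Submodule.comap (LinearMap.ker (cdiff k cw Y (j + 1))).subtype
          (LinearMap.range (cdiff k cw Y j))))

/-- The `i`-cells of the CW complex. -/
def cells (i : ℕ) : Type := {τ : cw.ι // cw.dim τ = i}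

noncomputable instance (i : ℕ) : Fintype (cells cw i) := by
  unfold cells; exact Fintype.ofFinite _

/-- The differential `F_{i+2} → F_{i+1}` of the cellular free complex `F_•^X`:
`e_σ ↦ ∑ [σ:τ]·x^{ρσ−ρτ}·e_τ`. -/
noncomputable def cellDiff (ρ : cw.ι → (Fin n →₀ ℕ)) (i : ℕ) :
    (cells cw (i + 1) → MvPolynomial (Fin n) k) →ₗ[MvPolynomial (Fin n) k]
      (cells cw i → MvPolynomial (Fin n) k) :=
  LinearMap.pi fun τ => ∑ σ : cells cw (i + 1),
    (monomial (ρ σ.1 - ρ τ.1) ((cw.inc σ.1 τ.1 : ℤ) : k)) • LinearMap.proj σ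

/-- The augmentation `F_1 → F_0 = S`, `e_v ↦ [v:∅]·x^{ρ(v)}`. -/
noncomputable def cellAug (ρ : cw.ι → (Fin n →₀ ℕ)) :
    (cells cw 0 → MvPolynomial (Fin n) k) →ₗ[MvPolynomial (Fin n) k]
      MvPolynomial (Fin n) k :=
  ∑ v : cells cw 0, (monomial (ρ v.1) ((cw.incEmpty v.1 : ℤ) : k)) • LinearMap.proj v

/-- `F_•^X` is a free resolution of `S/I` supported on `X`. -/
def IsCellularResolution (ρ : cw.ι → (Fin n →₀ ℕ)) (I : Ideal (MvPolynomial (Fin n) k)) :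
    Prop :=
  LinearMap.range (cellAug k cw ρ) = I ∧
  LinearMap.ker (cellAug k cw ρ) = LinearMap.range (cellDiff k cw ρ 0) ∧
  ∀ i : ℕ, LinearMap.ker (cellDiff k cw ρ i) = LinearMap.range (cellDiff k cw ρ (i + 1))

/-- Minimality of the cellular resolution: all entries of the differential matrices are
non-constant monomials. -/
def IsMinimalCellular (ρ : cw.ι → (Fin n →₀ ℕ)) : Prop :=
  (∀ σ τ : cw.ι, cw.inc σ τ ≠ 0 → ρ σ ≠ ρ τ) ∧ (∀ v : cw.ι, ρ v ≠ 0) ∧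
  (∀ σ τ : cw.ι, cw.cell τ ⊆ closure (cw.cell σ) → ρ τ ≤ ρ σ)

end Comb

/-- Cohen–Macaulayness of the graded quotient `S/I`. -/
def IsCMQuotient (I : Ideal (MvPolynomial (Fin n) k)) : Prop :=
  ∃ rs : List (MvPolynomial (Fin n) k),
    (∀ r ∈ rs, r ∈ Ideal.span (Set.range (X : Fin n → MvPolynomial (Fin n) k))) ∧
    RingTheory.Sequence.IsRegular (MvPolynomial (Fin n) k ⧸ I) rs ∧
    ringKrullDim (MvPolynomial (Fin n) k ⧸ I) = (rs.length : WithBot (WithTop ℕ))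

section ExtPart

open Abelian

variable {R : Type} [CommRing R]

/-- The short complex `0 → range f → B → range g → 0`. -/
noncomputable abbrev rangeSC {A B C : ModuleCat.{0} R} (f : A →ₗ[R] B) (g : B →ₗ[R] C)
    (h : LinearMap.ker g = LinearMap.range f) : ShortComplex (ModuleCat.{0} R) where
  X₁ := ModuleCat.of R (LinearMap.range f)
  X₂ := B
  X₃ := ModuleCat.of R (LinearMap.range g)
  f := ModuleCat.ofHom (LinearMap.range f).subtype
  g := ModuleCat.ofHom g.rangeRestrict
  zero := by
    ext ⟨x, hx⟩
    rw [← h] at hx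
    exact hx

lemma rangeSC_shortExact {A B C : ModuleCat.{0} R} (f : A →ₗ[R] B) (g : B →ₗ[R] C)
    (h : LinearMap.ker g = LinearMap.range f) : (rangeSC f g h).ShortExact where
  exact := by
    rw [ShortComplex.moduleCat_exact_iff]
    intro x hx
    have hx' : x ∈ LinearMap.ker g := by
      have := congrArg Subtype.val hx
      exact this
    rw [h] at hx'
    exact ⟨⟨x, hx'⟩, rfl⟩
  mono_f := by
    rw [ModuleCat.mono_iff_injective]
    exact Subtype.val_injective
  epi_g := by
    rw [ModuleCat.epi_iff_surjective]
    exact LinearMap.surjective_rangeRestrict g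

variable (A : ℕ → ModuleCat.{0} R) (δ : ∀ i, A (i + 1) →ₗ[R] A i)

/-- syzygy modules -/
noncomputable abbrev syz (i : ℕ) : ModuleCat.{0} R := ModuleCat.of R (LinearMap.range (δ i))

variable {A δ}

lemma ext_syz_shift (hex : ∀ i, LinearMap.ker (δ i) = LinearMap.range (δ (i + 1)))
    (hproj : ∀ i, Projective (A (i + 1))) (N : ModuleCat.{0} R) (i m : ℕ) :
    Subsingleton (Ext (syz A δ i) N (m + 2)) ↔ Subsingleton (Ext (syz A δ (i + 1)) N (m + 1)) := by
  have hS := rangeSC_shortExact (δ (i + 1)) (δ i) (hex i)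
  have := hproj i
  constructor
  · intro h
    refine ⟨fun x y => ?_⟩
    rw [← sub_eq_zero]
    obtain ⟨z, hz⟩ := Ext.contravariant_sequence_exact₁ hS N (x - y) (n₁ := m + 2) (by omega)
      (h.elim _ _)
    rw [← hz, Ext.eq_zero_of_projective (P := (rangeSC (δ (i + 1)) (δ i) (hex i)).X₂) z]
    simp
  · intro h
    refine ⟨fun x y => ?_⟩
    rw [← sub_eq_zero]
    obtain ⟨z, hz⟩ := Ext.contravariant_sequence_exact₃ hS N (x - y)
      (Ext.eq_zero_of_projective (P := (rangeSC (δ (i + 1)) (δ i) (hex i)).X₂) _)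
      (n₀ := m + 1) (by omega)
    rw [← hz, show z = 0 from h.elim _ _]
    simp

lemma ext_syz_one (hex : ∀ i, LinearMap.ker (δ i) = LinearMap.range (δ (i + 1)))
    (hproj : ∀ i, Projective (A (i + 1))) (N : ModuleCat.{0} R) (i : ℕ) :
    Subsingleton (Ext (syz A δ i) N 1) ↔
      ∀ f : A (i + 2) →ₗ[R] N, f ∘ₗ δ (i + 2) = 0 → ∃ g : A (i + 1) →ₗ[R] N,
        f = g ∘ₗ δ (i + 1) := by
  have hS := rangeSC_shortExact (δ (i + 1)) (δ i) (hex i)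
  have := hproj i
  constructor
  · intro h f hf
    have hk : LinearMap.ker (δ (i + 1)).rangeRestrict ≤ LinearMap.ker f := by
      rw [LinearMap.ker_rangeRestrict, hex (i + 1)]
      rintro _ ⟨x, rfl⟩
      exact LinearMap.congr_fun hf x
    obtain ⟨φ, hφ⟩ : ∃ φ : LinearMap.range (δ (i + 1)) →ₗ[R] N,
        φ ∘ₗ (δ (i + 1)).rangeRestrict = f := by
      refine ⟨((LinearMap.ker (δ (i + 1)).rangeRestrict).liftQ f hk) ∘ₗ
        ((δ (i + 1)).rangeRestrict.quotKerEquivOfSurjective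
          (LinearMap.surjective_rangeRestrict _)).symm.toLinearMap, ?_⟩
      ext x
      simp only [LinearMap.comp_apply, LinearEquiv.coe_coe]
      have : ((δ (i + 1)).rangeRestrict.quotKerEquivOfSurjective
          (LinearMap.surjective_rangeRestrict _)).symm ((δ (i + 1)).rangeRestrict x) =
          Submodule.Quotient.mk x := by
        rw [LinearEquiv.symm_apply_eq]; rfl
      rw [this]
      simp
    obtain ⟨z, hz⟩ := Ext.contravariant_sequence_exact₁ hS N
      (Ext.mk₀ (ModuleCat.ofHom φ : syz A δ (i + 1) ⟶ N)) (n₁ := 1) (by omega) (h.elim _ _)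
    obtain ⟨g, rfl⟩ := Ext.mk₀_bijective _ _ |>.2 z
    rw [Ext.mk₀_comp_mk₀] at hz
    have hz' := (Ext.mk₀_bijective _ _).1 hz
    refine ⟨g.hom, ?_⟩
    rw [← hφ]
    ext x
    have := congrArg (fun t => t.hom ((δ (i + 1)).rangeRestrict x)) hz'
    exact this.symm
  · intro h
    refine ⟨fun x y => ?_⟩
    rw [← sub_eq_zero]
    obtain ⟨z, hz⟩ := Ext.contravariant_sequence_exact₃ hS N (x - y)
      (Ext.eq_zero_of_projective (P := (rangeSC (δ (i + 1)) (δ i) (hex i)).X₂) _)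
      (n₀ := 0) (by omega)
    obtain ⟨φ, rfl⟩ := Ext.mk₀_bijective _ _ |>.2 z
    obtain ⟨g, hg⟩ := h (φ.hom ∘ₗ (δ (i + 1)).rangeRestrict) (by
      ext x
      have : (δ (i + 1)).rangeRestrict (δ (i + 2) x) = 0 := by
        apply Subtype.ext
        have : δ (i + 2) x ∈ LinearMap.ker (δ (i + 1)) := by
          rw [hex]; exact ⟨x, rfl⟩
        exact this
      simp only [LinearMap.comp_apply, this, map_zero, LinearMap.zero_apply])
    have : φ = (rangeSC (δ (i + 1)) (δ i) (hex i)).f ≫ ModuleCat.ofHom g := by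
      ext ⟨x, y, rfl⟩
      exact LinearMap.congr_fun hg y
    rw [← hz, this, ← Ext.mk₀_comp_mk₀, ← Ext.comp_assoc_of_second_deg_zero,
      hS.extClass_comp]
    simp

lemma ext_syz (hex : ∀ i, LinearMap.ker (δ i) = LinearMap.range (δ (i + 1)))
    (hproj : ∀ i, Projective (A (i + 1))) (N : ModuleCat.{0} R) (i j : ℕ) :
    Subsingleton (Ext (syz A δ j) N (i + 1)) ↔
      ∀ f : A (i + j + 2) →ₗ[R] N, f ∘ₗ δ (i + j + 2) = 0 → ∃ g : A (i + j + 1) →ₗ[R] N,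
        f = g ∘ₗ δ (i + j + 1) := by
  induction i generalizing j with
  | zero =>
    rw [ext_syz_one hex hproj, show 0 + j = j by omega]
  | succ i ih =>
    rw [ext_syz_shift hex hproj, ih, show i + (j + 1) = i + 1 + j by omega]

/-- covariant shift, nonvanishing -/
lemma ext_syz_ne (hex : ∀ i, LinearMap.ker (δ i) = LinearMap.range (δ (i + 1)))
    (K : ModuleCat.{0} R) (i m : ℕ) (h0 : Subsingleton (Ext K (A (i + 1)) (m + 1)))
    (h : Subsingleton (Ext K (syz A δ i) m)) : Subsingleton (Ext K (syz A δ (i + 1)) (m + 1)) := by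
  have hS := rangeSC_shortExact (δ (i + 1)) (δ i) (hex i)
  refine ⟨fun x y => ?_⟩
  rw [← sub_eq_zero]
  obtain ⟨z, hz⟩ := Ext.covariant_sequence_exact₁ K hS (x - y) (h0.elim _ _) (n₀ := m) rfl
  rw [← hz, show z = 0 from h.elim _ _]
  simp

/-- covariant shift, vanishing -/
lemma ext_syz_van (hex : ∀ i, LinearMap.ker (δ i) = LinearMap.range (δ (i + 1)))
    (K : ModuleCat.{0} R) (i m : ℕ) (h0 : Subsingleton (Ext K (A (i + 1)) m))
    (h : Subsingleton (Ext K (syz A δ (i + 1)) (m + 1))) : Subsingleton (Ext K (syz A δ i) m) := by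
  have hS := rangeSC_shortExact (δ (i + 1)) (δ i) (hex i)
  refine ⟨fun x y => ?_⟩
  rw [← sub_eq_zero]
  obtain ⟨z, hz⟩ := Ext.covariant_sequence_exact₃ K hS (x - y) (n₁ := m + 1) rfl (h.elim _ _)
  rw [← hz, show z = 0 from h0.elim _ _]
  simp

lemma ext_subsingleton_of_retract (K : ModuleCat.{0} R) {M N : ModuleCat.{0} R} (f : M ⟶ N)
    (g : N ⟶ M) (h : f ≫ g = 𝟙 M) (m : ℕ) (hN : Subsingleton (Ext K N m)) :
    Subsingleton (Ext K M m) := by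
  refine ⟨fun x y => ?_⟩
  have key : ∀ x : Ext K M m, x = 0 := by
    intro x
    rw [← Ext.comp_mk₀_id x, ← h, ← Ext.mk₀_comp_mk₀, ← Ext.comp_assoc_of_third_deg_zero,
      show x.comp (Ext.mk₀ f) (add_zero m) = 0 from hN.elim _ _]
    simp
  rw [key x, key y]

lemma ext_subsingleton_of_retract' (K : ModuleCat.{0} R) {M N : ModuleCat.{0} R} (f : M ⟶ N)
    (g : N ⟶ M) (h : f ≫ g = 𝟙 M) (m : ℕ) (hN : Subsingleton (Ext N K m)) :
    Subsingleton (Ext M K m) := by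
  refine ⟨fun x y => ?_⟩
  have key : ∀ x : Ext M K m, x = 0 := by
    intro x
    rw [← Ext.mk₀_id_comp x, ← h, ← Ext.mk₀_comp_mk₀, Ext.comp_assoc_of_second_deg_zero,
      show (Ext.mk₀ g).comp x (zero_add m) = 0 from hN.elim _ _]
    simp
  rw [key x, key y]

lemma ext_pi_subsingleton (K : ModuleCat.{0} R) (α : Type) [Finite α] (m : ℕ)
    (h : Subsingleton (Ext K (ModuleCat.of R R) m)) :
    Subsingleton (Ext K (ModuleCat.of R (α → R)) m) := by
  classical
  have := Fintype.ofFinite α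
  have key : ∀ x : Ext K (ModuleCat.of R (α → R)) m, x = 0 := by
    intro x
    have hid : 𝟙 (ModuleCat.of R (α → R)) = ∑ a : α,
        (ModuleCat.ofHom (LinearMap.proj a : (α → R) →ₗ[R] R)) ≫
          (ModuleCat.ofHom (LinearMap.single R (fun _ : α => R) a)) := by
      ext f b
      simp [Finset.sum_apply, Pi.single_apply]
    rw [← Ext.comp_mk₀_id x, hid, Ext.mk₀_sum, Ext.comp_sum]
    refine Finset.sum_eq_zero fun a _ => ?_
    rw [← Ext.mk₀_comp_mk₀, ← Ext.comp_assoc_of_third_deg_zero,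
      show x.comp (Ext.mk₀ (ModuleCat.ofHom (LinearMap.proj a : (α → R) →ₗ[R] R))) (add_zero m) = 0 from h.elim _ _]
    simp
  exact ⟨fun x y => by rw [key x, key y]⟩

lemma ext_comp_mem_smul_top (K : ModuleCat.{0} R) (J : Ideal R) (hJ : J ≤ Module.annihilator R K)
    {M N : ModuleCat.{0} R} (f : M →ₗ[R] N) (hf : f ∈ J • (⊤ : Submodule R (M →ₗ[R] N))) (m : ℕ)
    (x : Ext K M m) : x.comp (Ext.mk₀ (ModuleCat.ofHom f)) (add_zero m) = 0 := by
  induction hf using Submodule.smul_induction_on' with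
  | smul r hr g hg =>
    have h1 : ModuleCat.ofHom (r • g) = r • (ModuleCat.ofHom g) := rfl
    have h2 : r • 𝟙 K = 0 := by
      ext y
      exact (Module.mem_annihilator.mp (hJ hr)) y
    have h3 : r • x = 0 := by
      rw [← Ext.mk₀_id_comp x, ← Ext.smul_comp, ← Ext.mk₀_smul, h2]
      simp
    rw [h1, Ext.mk₀_smul, Ext.comp_smul, ← Ext.smul_comp, h3]
    simp
  | add f hf g hg ihf ihg =>
    rw [ModuleCat.ofHom_add, Ext.mk₀_add, Ext.comp_add, ihf, ihg, add_zero]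

lemma ext_zero_subsingleton (M N : ModuleCat.{0} R) (h : Subsingleton (M →ₗ[R] N)) :
    Subsingleton (Ext M N 0) :=
  (Ext.addEquiv₀.trans ModuleCat.homAddEquiv).subsingleton

lemma supportDim_add_length_le [IsNoetherianRing R] (M : Type) [AddCommGroup M] [Module R M] [Module.Finite R M]
    (rs : List R) (reg : RingTheory.Sequence.IsWeaklyRegular M rs) :
    Module.supportDim R (M ⧸ Ideal.ofList rs • (⊤ : Submodule R M)) + rs.length ≤
      Module.supportDim R M := by
  induction rs generalizing M with
  | nil =>
    rw [Ideal.ofList_nil, Submodule.bot_smul]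
    simpa using (Module.supportDim_eq_of_equiv (R := R) (Submodule.quotEquivOfEqBot (⊥ : Submodule R M) rfl)).le
  | cons x rs' ih =>
    rw [RingTheory.Sequence.isWeaklyRegular_cons_iff] at reg
    have h1 := Module.supportDim_quotSMulTop_succ_le_of_notMem_minimalPrimes (R := R) (M := M) (x := x)
      (fun _ ↦ reg.1.notMem_of_mem_minimalPrimes)
    have h2 := ih _ reg.2
    rw [Module.supportDim_eq_of_equiv (Submodule.quotOfListConsSMulTopEquivQuotSMulTopInner M x _)]
    refine le_trans ?_ h1
    simp only [List.length_cons, Nat.cast_add, Nat.cast_one, ← add_assoc]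
    gcongr

lemma length_le_supportDim [IsNoetherianRing R] (M : Type) [AddCommGroup M] [Module R M] [Module.Finite R M]
    (rs : List R) (reg : RingTheory.Sequence.IsRegular M rs) :
    (rs.length : WithBot ℕ∞) ≤ Module.supportDim R M := by
  refine le_trans ?_ (supportDim_add_length_le M rs reg.toIsWeaklyRegular)
  have : Nontrivial (M ⧸ Ideal.ofList rs • (⊤ : Submodule R M)) :=
    Submodule.Quotient.nontrivial_iff.mpr reg.top_ne_smul.symm
  have h := Module.supportDim_ne_bot_of_nontrivial R (M ⧸ Ideal.ofList rs • (⊤ : Submodule R M))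
  have : (0 : WithBot ℕ∞) ≤ Module.supportDim R (M ⧸ Ideal.ofList rs • (⊤ : Submodule R M)) := by
    revert h
    generalize Module.supportDim R (M ⧸ Ideal.ofList rs • (⊤ : Submodule R M)) = e
    intro h
    obtain ⟨e, rfl⟩ := WithBot.ne_bot_iff_exists.mp h
    exact_mod_cast zero_le
  calc (rs.length : WithBot ℕ∞) = 0 + rs.length := by simp
    _ ≤ _ := by gcongr

end ExtPart
section PolyPart

open Abelian RingTheory.Sequence

variable {F : Type} [Field F] {m : ℕ}

/-- the irrelevant ideal -/
noncomputable abbrev irrel (F : Type) [Field F] (m : ℕ) : Ideal (MvPolynomial (Fin m) F) :=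
  Ideal.span (Set.range (X : Fin m → MvPolynomial (Fin m) F))

lemma irrel_ne_top : irrel F m ≠ ⊤ := by
  intro h
  rw [Ideal.eq_top_iff_one, irrel, ← Set.image_univ, mem_ideal_span_X_image] at h
  obtain ⟨i, -, hi⟩ := h 0 (by simp)
  simp at hi

lemma monomial_mem_irrel (e : Fin m →₀ ℕ) (he : e ≠ 0) (c : F) : monomial e c ∈ irrel F m := by
  rw [irrel, ← Set.image_univ, mem_ideal_span_X_image]
  intro e' he'
  have := Finset.mem_singleton.mp (support_monomial_subset he')
  subst this
  obtain ⟨i, hi⟩ := Finsupp.ne_iff.mp he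
  exact ⟨i, trivial, hi⟩

lemma vars_isWeaklyRegular (l : List (Fin m)) (hl : l.Nodup) :
    IsWeaklyRegular (MvPolynomial (Fin m) F)
      (l.map (X : Fin m → MvPolynomial (Fin m) F)) := by
  rw [isWeaklyRegular_iff]
  intro i hi
  rw [isSMulRegular_quotient_iff_mem_of_smul_mem]
  have hof : Ideal.ofList (List.take i (l.map (X : Fin m → MvPolynomial (Fin m) F))) •
      (⊤ : Ideal (MvPolynomial (Fin m) F)) =
      Ideal.span (X '' {v | v ∈ l.take i}) := by
    rw [smul_eq_mul, Ideal.mul_top, Ideal.ofList, ← List.map_take]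
    congr 1
    ext f
    simp only [Set.mem_ofPred_eq, Set.mem_image, List.mem_map]
  intro f hf
  rw [hof, mem_ideal_span_X_image] at hf ⊢
  have hi' : i < l.length := by simpa using hi
  intro e he
  obtain ⟨v, hv, hne⟩ := hf (Finsupp.single (l[i]) 1 + e) (by
    rw [MvPolynomial.mem_support_iff] at he ⊢
    simpa [List.getElem_map, smul_eq_mul, coeff_X_mul] using he)
  refine ⟨v, hv, ?_⟩
  have hvi : l[i] ≠ v := by
    rintro rfl
    obtain ⟨j, hj, hje⟩ := List.mem_take_iff_getElem.mp hv
    have := (List.Nodup.getElem_inj_iff hl).mp hje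
    omega
  simpa [Finsupp.single_apply, hvi] using hne

lemma vars_isRegular (l : List (Fin m)) (hl : l.Nodup) :
    IsRegular (MvPolynomial (Fin m) F)
      (l.map (X : Fin m → MvPolynomial (Fin m) F)) := by
  refine ⟨vars_isWeaklyRegular l hl, fun h => irrel_ne_top (F := F) (m := m) ?_⟩
  rw [eq_top_iff, h, smul_eq_mul, Ideal.mul_top, Ideal.ofList]
  refine Ideal.span_mono ?_
  rintro f hf
  obtain ⟨v, -, rfl⟩ := List.mem_map.mp hf
  exact ⟨v, rfl⟩

lemma smul_top_lt_of_le (J : Ideal (MvPolynomial (Fin m) F)) (hJ : J ≤ irrel F m) :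
    J • (⊤ : Submodule (MvPolynomial (Fin m) F) (MvPolynomial (Fin m) F)) < ⊤ := by
  rw [smul_eq_mul, Ideal.mul_top]
  exact lt_of_le_of_lt hJ irrel_ne_top.lt_top

lemma support_quot (J : Ideal (MvPolynomial (Fin m) F)) :
    Module.support (MvPolynomial (Fin m) F) (MvPolynomial (Fin m) F ⧸ J) =
      PrimeSpectrum.zeroLocus J := by
  rw [Module.support_eq_zeroLocus, Ideal.annihilator_quotient]

lemma ext_vanish_of_vars (N : ModuleCat.{0} (MvPolynomial (Fin m) F))
    [Module.Finite (MvPolynomial (Fin m) F) N] (V : Finset (Fin m))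
    (hN : ∀ Q ∈ Module.support (MvPolynomial (Fin m) F) N, ∀ v ∈ V,
      (X v : MvPolynomial (Fin m) F) ∈ Q.asIdeal) (i : ℕ) (hi : i < V.card) :
    Subsingleton (Ext N (ModuleCat.of (MvPolynomial (Fin m) F) (MvPolynomial (Fin m) F)) i) := by
  refine ModuleCat.subsingleton_ext_of_exists_isRegular (Ideal.span (X '' (V : Set (Fin m)))) N
    ?_ (ModuleCat.of (MvPolynomial (Fin m) F) (MvPolynomial (Fin m) F)) ?_
    (V.toList.map (X : Fin m → MvPolynomial (Fin m) F)) ?_ (vars_isRegular _ V.nodup_toList) i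
    (by simpa using hi)
  · intro Q hQ
    rw [PrimeSpectrum.mem_zeroLocus, SetLike.coe_subset_coe, Ideal.span_le]
    rintro _ ⟨v, hv, rfl⟩
    exact hN Q hQ v hv
  · exact smul_top_lt_of_le _ (Ideal.span_mono (Set.image_subset_range _ _))
  · intro r hr
    obtain ⟨v, hv, rfl⟩ := List.mem_map.mp hr
    exact Ideal.subset_span ⟨v, by simpa using hv, rfl⟩

/-- The residue field as a module. -/
noncomputable abbrev resK (F : Type) [Field F] (m : ℕ) : ModuleCat.{0} (MvPolynomial (Fin m) F) :=
  ModuleCat.of (MvPolynomial (Fin m) F) (MvPolynomial (Fin m) F ⧸ irrel F m)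

lemma ext_resK_vanish (i : ℕ) (hi : i < m) :
    Subsingleton (Ext (resK F m) (ModuleCat.of (MvPolynomial (Fin m) F) (MvPolynomial (Fin m) F)) i) := by
  refine ext_vanish_of_vars _ Finset.univ ?_ i (by simpa using hi)
  intro Q hQ v _
  rw [support_quot, PrimeSpectrum.mem_zeroLocus] at hQ
  exact hQ (Ideal.subset_span ⟨v, rfl⟩)

lemma ringKrullDim_poly : ringKrullDim (MvPolynomial (Fin m) F) = m := by
  rw [MvPolynomial.ringKrullDim_of_isNoetherianRing, ringKrullDim_eq_zero_of_field]
  simp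

lemma ext_resK_ne : ¬ Subsingleton (Ext (resK F m) (ModuleCat.of (MvPolynomial (Fin m) F) (MvPolynomial (Fin m) F)) m) := by
  intro h
  obtain ⟨rs, hlen, -, hreg⟩ := ModuleCat.exists_isRegular_of_exists_subsingleton_ext
    (irrel F m) (m + 1) (ModuleCat.of (MvPolynomial (Fin m) F) (MvPolynomial (Fin m) F))
    (smul_top_lt_of_le _ le_rfl) (resK F m) (support_quot _) (by
      intro i hi
      rcases Nat.lt_succ_iff_lt_or_eq.mp hi with h' | rfl
      · exact ext_resK_vanish i h'
      · exact h)
  have := length_le_supportDim (MvPolynomial (Fin m) F) rs hreg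
  rw [Module.supportDim_self_eq_ringKrullDim, ringKrullDim_poly, hlen] at this
  have h2 : m + 1 ≤ m := by exact_mod_cast this
  omega

lemma ext_grade (c : ℕ) (J : Ideal (MvPolynomial (Fin m) F))
    (hJ : ∀ Q : Ideal (MvPolynomial (Fin m) F), Q.IsPrime → J ≤ Q → ∃ V : Finset (Fin m),
      c ≤ V.card ∧ ∀ v ∈ V, (X v : MvPolynomial (Fin m) F) ∈ Q) (i : ℕ) (hi : i < c) :
    Subsingleton (Ext (ModuleCat.of (MvPolynomial (Fin m) F) (MvPolynomial (Fin m) F ⧸ J))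
      (ModuleCat.of (MvPolynomial (Fin m) F) (MvPolynomial (Fin m) F)) i) := by
  have key : ∀ (N : Type) [AddCommGroup N] [Module (MvPolynomial (Fin m) F) N]
      (_ : Module.Finite (MvPolynomial (Fin m) F) N),
      (Module.support (MvPolynomial (Fin m) F) N ⊆ PrimeSpectrum.zeroLocus J) →
      Subsingleton (Ext (ModuleCat.of (MvPolynomial (Fin m) F) N)
        (ModuleCat.of (MvPolynomial (Fin m) F) (MvPolynomial (Fin m) F)) i) := by
    intro N _ _ hfin
    induction hfin using IsNoetherianRing.induction_on_isQuotientEquivQuotientPrime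
      (MvPolynomial (Fin m) F) with
    | subsingleton N =>
      intro _
      have : IsZero (ModuleCat.of (MvPolynomial (Fin m) F) N) :=
        ModuleCat.isZero_iff_subsingleton.mpr ‹_›
      refine ⟨fun x y => ?_⟩
      rw [← Ext.mk₀_id_comp x, ← Ext.mk₀_id_comp y, this.eq_zero_of_src (𝟙 _)]
      simp
    | quotient N p e =>
      intro hsupp
      have hs : Module.support (MvPolynomial (Fin m) F) N = PrimeSpectrum.zeroLocus p.1 := by
        rw [e.support_eq, support_quot]
      have hp : J ≤ p.1 := by
        have : p ∈ PrimeSpectrum.zeroLocus (J : Set (MvPolynomial (Fin m) F)) := by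
          apply hsupp
          rw [hs]
          exact fun x hx => hx
        exact this
      obtain ⟨V, hV, hV'⟩ := hJ p.1 p.2 hp
      refine ext_vanish_of_vars _ V ?_ i (by omega)
      intro Q hQ v hv
      have hQ' : Q ∈ PrimeSpectrum.zeroLocus p.1 := hs ▸ hQ
      exact hQ' (hV' v hv)
    | exact N₁ N₂ N₃ f g hf hg hfg h₁ h₃ =>
      intro hsupp
      have H₁ := h₁ ((Module.support_subset_of_injective f hf).trans hsupp)
      have H₃ := h₃ ((Module.support_subset_of_surjective g hg).trans hsupp)
      let SC : ShortComplex (ModuleCat.{0} (MvPolynomial (Fin m) F)) :=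
        { X₁ := ModuleCat.of _ N₁, X₂ := ModuleCat.of _ N₂, X₃ := ModuleCat.of _ N₃
          f := ModuleCat.ofHom f, g := ModuleCat.ofHom g
          zero := by ext x; exact hfg.apply_apply_eq_zero x }
      have hS : SC.ShortExact :=
        { exact := by
            rw [ShortComplex.moduleCat_exact_iff]
            intro x hx
            exact (hfg x).mp hx
          mono_f := (ModuleCat.mono_iff_injective _).mpr hf
          epi_g := (ModuleCat.epi_iff_surjective _).mpr hg }
      refine ⟨fun x y => ?_⟩
      rw [← sub_eq_zero]
      obtain ⟨z, hz⟩ := Ext.contravariant_sequence_exact₂ hS _ (x - y) (H₁.elim _ _)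
      rw [← hz, show z = 0 from H₃.elim _ _]
      simp
  exact key (MvPolynomial (Fin m) F ⧸ J) inferInstance (support_quot J).subset

lemma dim_quot_ge (J : Ideal (MvPolynomial (Fin m) F)) (V : Finset (Fin m))
    (hJ : J ≤ Ideal.span (X '' (V : Set (Fin m)))) :
    ((m - V.card : ℕ) : WithBot ℕ∞) ≤ ringKrullDim (MvPolynomial (Fin m) F ⧸ J) := by
  classical
  let φ : MvPolynomial (Fin m) F →ₐ[F] MvPolynomial {v // v ∉ V} F :=
    aeval (fun v => if h : v ∉ V then X ⟨v, h⟩ else 0)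
  have hφ : Function.Surjective φ := by
    intro f
    refine ⟨rename Subtype.val f, ?_⟩
    rw [aeval_rename]
    have : ((fun v => if h : v ∉ V then (X ⟨v, h⟩ : MvPolynomial {v // v ∉ V} F) else 0) ∘
        (Subtype.val : {v // v ∉ V} → Fin m)) = X := by
      ext1 v
      simp [v.2]
    rw [this]
    simp
  have hker : ∀ f ∈ J, φ f = 0 := by
    intro f hf
    have : J ≤ RingHom.ker φ := by
      refine hJ.trans ?_
      rw [Ideal.span_le]
      rintro _ ⟨v, hv, rfl⟩
      have : v ∈ V := hv
      simp [φ, RingHom.mem_ker, this]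
    exact this hf
  have h := ringKrullDim_le_of_surjective (Ideal.Quotient.lift J φ.toRingHom hker)
    (Ideal.Quotient.lift_surjective_of_surjective _ _ hφ)
  refine le_trans ?_ h
  rw [MvPolynomial.ringKrullDim_of_isNoetherianRing, ringKrullDim_eq_zero_of_field, zero_add]
  simp

lemma irrel_smul_quot_lt (J : Ideal (MvPolynomial (Fin m) F)) (hJ : J ≤ irrel F m) :
    irrel F m • (⊤ : Submodule (MvPolynomial (Fin m) F) (MvPolynomial (Fin m) F ⧸ J)) < ⊤ := by
  rw [lt_top_iff_ne_top]
  intro h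
  have h1 : (1 : MvPolynomial (Fin m) F ⧸ J) ∈
      irrel F m • (⊤ : Submodule (MvPolynomial (Fin m) F) (MvPolynomial (Fin m) F ⧸ J)) := by
    rw [h]; trivial
  have h2 : ∀ x ∈ irrel F m • (⊤ : Submodule (MvPolynomial (Fin m) F) (MvPolynomial (Fin m) F ⧸ J)),
      Ideal.Quotient.factor hJ x = 0 := by
    intro x hx
    induction hx using Submodule.smul_induction_on' with
    | smul r hr y hy =>
      obtain ⟨y, rfl⟩ := Ideal.Quotient.mk_surjective y
      have : r • (Ideal.Quotient.mk J y) = Ideal.Quotient.mk J (r * y) := rfl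
      rw [this, Ideal.Quotient.factor_mk, Ideal.Quotient.eq_zero_iff_mem]
      exact Ideal.mul_mem_right _ _ hr
    | add x _ y _ hx hy => rw [map_add, hx, hy, add_zero]
  have h3 := h2 1 h1
  rw [map_one] at h3
  exact irrel_ne_top ((Ideal.eq_top_iff_one _).mpr (Ideal.Quotient.eq_zero_iff_mem.mp h3))

end PolyPart
section StrandPart

lemma strand_exact {ι : Type} {U V W : Type} [AddCommGroup U] [AddCommGroup V] [AddCommGroup W]
    {Ua Va Wa : ι → Type} [∀ a, AddCommGroup (Ua a)] [∀ a, AddCommGroup (Va a)]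
    [∀ a, AddCommGroup (Wa a)]
    (α : U →+ V) (β : V →+ W) (αa : ∀ a, Ua a →+ Va a) (βa : ∀ a, Va a →+ Wa a)
    (sU : ∀ a, U →+ Ua a) (sV : ∀ a, V →+ Va a) (sW : ∀ a, W →+ Wa a)
    (lU : ∀ a, Ua a → U) (lV : ∀ a, Va a → V)
    (hα : ∀ a u, sV a (α u) = αa a (sU a u)) (hβ : ∀ a v, sW a (β v) = βa a (sV a v))
    (sepV : ∀ v, (∀ a, sV a v = 0) → v = 0) (sepW : ∀ w, (∀ a, sW a w = 0) → w = 0)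
    (finV : ∀ v, ∃ T : Finset ι, ∀ a, a ∉ T → sV a v = 0)
    (lV1 : ∀ a c, sV a (lV a c) = c) (lV2 : ∀ a a' c, a' ≠ a → sV a' (lV a c) = 0)
    (lU1 : ∀ a c, αa a (sU a (lU a c)) = αa a c) (lU2 : ∀ a a' c, a' ≠ a → sU a' (lU a c) = 0) :
    (∀ f, β f = 0 → ∃ g, f = α g) ↔ ∀ a, ∀ c, βa a c = 0 → ∃ e, αa a e = c := by
  classical
  constructor
  · intro h a c hc
    obtain ⟨g, hg⟩ := h (lV a c) (sepW _ fun a' => by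
      rw [hβ]
      by_cases h' : a' = a
      · subst h'; rw [lV1, hc]
      · rw [lV2 _ _ _ h', map_zero])
    exact ⟨sU a g, by rw [← hα, ← hg, lV1]⟩
  · intro h f hf
    have h1 : ∀ a, ∃ e, αa a e = sV a f := fun a => h a _ (by rw [← hβ, hf, map_zero])
    choose e he using h1
    obtain ⟨T, hT⟩ := finV f
    refine ⟨∑ a ∈ T, lU a (e a), ?_⟩
    rw [← sub_eq_zero]
    apply sepV
    intro a
    rw [map_sub, hα, map_sum, sub_eq_zero]
    by_cases ha : a ∈ T
    · rw [Finset.sum_eq_single_of_mem a ha (fun b _ hb => lU2 _ _ _ (Ne.symm hb)), lU1, he]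
    · rw [Finset.sum_eq_zero, map_zero, hT a ha]
      intro b hb
      exact lU2 _ _ _ (fun h => ha (h ▸ hb))

variable {F : Type} [Field F] {m : ℕ} {Xs : Type} [TopologicalSpace Xs] {cx : FinRegCWI Xs}
  (r : cx.ι → (Fin m →₀ ℕ))

/-- exponent `ρ(σ) - a` -/
noncomputable def expo (a : Fin m → ℤ) (σ : cx.ι) : Fin m →₀ ℕ :=
  Finsupp.equivFunOnFinite.symm (fun j => ((r σ j : ℤ) - a j).toNat)

lemma expo_apply (a : Fin m → ℤ) (σ : cx.ι) (j : Fin m) :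
    expo r a σ j = ((r σ j : ℤ) - a j).toNat := rfl

/-- cells above `a` -/
abbrev above (a : Fin m → ℤ) : Set cx.ι := {σ | ∀ j, a j ≤ (r σ j : ℤ)}

/-- dual of a free module on cells -/
abbrev Dual (F : Type) [Field F] (m : ℕ) (cx : FinRegCWI Xs) (i : ℕ) : Type :=
  (cells cx i → MvPolynomial (Fin m) F) →ₗ[MvPolynomial (Fin m) F] MvPolynomial (Fin m) F

open Classical in
/-- the basis vector -/
noncomputable abbrev bas (F : Type) [Field F] (m : ℕ) {i : ℕ} (τ : cells cx i) :
    cells cx i → MvPolynomial (Fin m) F := Pi.single τ 1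

/-- forget that a cell lies in `Y` -/
def toCell {Y : Set cx.ι} {i : ℕ} (τ : cellsIn cx Y i) : cells cx i := ⟨τ.1, τ.2.2⟩

/-- a cell that lies in `Y` -/
def ofCell {Y : Set cx.ι} {i : ℕ} (τ : cells cx i) (h : τ.1 ∈ Y) : cellsIn cx Y i := ⟨τ.1, h, τ.2⟩

lemma toCell_val {Y : Set cx.ι} {i : ℕ} (τ : cellsIn cx Y i) : (toCell τ).1 = τ.1 := rfl

/-- the degree `a` strand -/
noncomputable def strand (a : Fin m → ℤ) (i : ℕ) :
    Dual F m cx i →+ (cellsIn cx (above r a) i → F) where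
  toFun f := fun τ => coeff (expo r a τ.1) (f (bas F m (toCell τ)))
  map_zero' := by ext; simp
  map_add' f g := by ext; simp

lemma strand_apply (a : Fin m → ℤ) (i : ℕ) (f : Dual F m cx i) (τ : cellsIn cx (above r a) i) :
    strand r a i f τ = coeff (expo r a τ.1) (f (bas F m (toCell τ))) := rfl

open Classical in
/-- lift from the strand -/
noncomputable def slift (a : Fin m → ℤ) (i : ℕ) (c : cellsIn cx (above r a) i → F) :
    Dual F m cx i :=
  Module.piEquiv _ _ _ (fun τ : cells cx i =>
    if h : τ.1 ∈ above r a then monomial (expo r a τ.1) (c (ofCell τ h)) else 0)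

lemma piEquiv_bas (i : ℕ) (v : cells cx i → MvPolynomial (Fin m) F) (τ : cells cx i) :
    Module.piEquiv _ (MvPolynomial (Fin m) F) _ v (bas F m τ) = v τ := by
  classical
  rw [Module.piEquiv_apply_apply]
  rw [Finset.sum_eq_single τ]
  · simp [bas]
  · intro b _ hb
    simp [bas, hb]
  · simp

lemma dual_ext {i : ℕ} {f g : Dual F m cx i} (h : ∀ τ, f (bas F m τ) = g (bas F m τ)) : f = g := by
  classical
  refine LinearMap.pi_ext' fun τ => ?_
  ext
  simpa [bas] using congrArg (coeff _) (h τ)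

lemma slift_pos (a : Fin m → ℤ) (i : ℕ) (c : cellsIn cx (above r a) i → F) (τ : cells cx i)
    (h : τ.1 ∈ above r a) :
    slift r a i c (bas F m τ) = monomial (expo r a τ.1) (c (ofCell τ h)) :=
  (piEquiv_bas i _ τ).trans (dif_pos h)

lemma slift_neg (a : Fin m → ℤ) (i : ℕ) (c : cellsIn cx (above r a) i → F) (τ : cells cx i)
    (h : τ.1 ∉ above r a) :
    slift r a i c (bas F m τ) = 0 :=
  (piEquiv_bas i _ τ).trans (dif_neg h)

lemma strand_slift (a : Fin m → ℤ) (i : ℕ) (c : cellsIn cx (above r a) i → F) :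
    strand r a i (slift r a i c) = c := by
  ext τ
  have h : (toCell τ).1 ∈ above r a := τ.2.1
  refine (congrArg (coeff (expo r a (toCell τ).1)) (slift_pos r a i c (toCell τ) h)).trans ?_
  rw [coeff_monomial, if_pos rfl]
  rfl

lemma expo_inj (a a' : Fin m → ℤ) (σ : cx.ι) (h : σ ∈ above r a) (h' : σ ∈ above r a')
    (he : expo r a σ = expo r a' σ) : a = a' := by
  ext j
  have := DFunLike.congr_fun he j
  simp only [expo_apply] at this
  have h1 := h j
  have h2 := h' j
  omega

lemma strand_slift_ne (a a' : Fin m → ℤ) (hne : a' ≠ a) (i : ℕ)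
    (c : cellsIn cx (above r a) i → F) :
    strand r a' i (slift r a i c) = 0 := by
  ext τ
  have h' : (toCell τ).1 ∈ above r a' := τ.2.1
  by_cases h : (toCell τ).1 ∈ above r a
  · refine (congrArg (coeff (expo r a' (toCell τ).1)) (slift_pos r a i c (toCell τ) h)).trans ?_
    rw [coeff_monomial, if_neg (fun he => hne (expo_inj r a a' _ h h' he).symm)]
    rfl
  · refine (congrArg (coeff (expo r a' (toCell τ).1)) (slift_neg r a i c (toCell τ) h)).trans ?_
    simp

lemma exists_expo (σ : cx.ι) (b : Fin m →₀ ℕ) :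
    σ ∈ above r (fun j => (r σ j : ℤ) - b j) ∧ expo r (fun j => (r σ j : ℤ) - b j) σ = b := by
  constructor
  · intro j
    dsimp only
    omega
  · ext j
    simp [expo_apply]

lemma strand_sep (i : ℕ) (f : Dual F m cx i) (h : ∀ a, strand r a i f = 0) : f = 0 := by
  refine dual_ext fun τ => ?_
  ext b
  obtain ⟨h1, h2⟩ := exists_expo r τ.1 b
  have h3 : coeff (expo r (fun j => (r τ.1 j : ℤ) - b j) τ.1) (f (bas F m τ)) = 0 :=
    congrFun (h (fun j => (r τ.1 j : ℤ) - b j)) (ofCell τ h1)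
  rw [h2] at h3
  rw [h3]
  simp

lemma strand_fin (i : ℕ) (f : Dual F m cx i) :
    ∃ T : Finset (Fin m → ℤ), ∀ a, a ∉ T → strand r a i f = 0 := by
  classical
  refine ⟨Finset.univ.biUnion fun τ : cells cx i =>
    (f (bas F m τ)).support.image (fun b => fun j => (r τ.1 j : ℤ) - b j), ?_⟩
  intro a ha
  ext τ
  by_contra hne
  apply ha
  rw [Finset.mem_biUnion]
  refine ⟨toCell τ, Finset.mem_univ _, Finset.mem_image.mpr ⟨expo r a τ.1, ?_, ?_⟩⟩
  · rw [MvPolynomial.mem_support_iff]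
    exact hne
  · ext j
    have h : a j ≤ (r τ.1 j : ℤ) := τ.2.1 j
    simp only [expo_apply, toCell_val]
    omega

lemma cellDiff_bas (i : ℕ) (g : Dual F m cx i) (σ : cells cx (i + 1)) :
    g (cellDiff F cx r i (bas F m σ)) =
      ∑ τ : cells cx i, monomial (r σ.1 - r τ.1) ((cx.inc σ.1 τ.1 : ℤ) : F) * g (bas F m τ) := by
  classical
  conv_lhs => rw [← (Module.piEquiv _ (MvPolynomial (Fin m) F) _).apply_symm_apply g]
  rw [Module.piEquiv_apply_apply]
  refine Finset.sum_congr rfl fun τ _ => ?_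
  rw [smul_eq_mul]
  congr 1
  · simp only [cellDiff, LinearMap.pi_apply, LinearMap.sum_apply, LinearMap.smul_apply,
      LinearMap.proj_apply, smul_eq_mul, bas]
    rw [Finset.sum_eq_single σ]
    · simp
    · intro b _ hb
      simp [hb]
    · simp

lemma cellAug_bas (g : MvPolynomial (Fin m) F →ₗ[MvPolynomial (Fin m) F] MvPolynomial (Fin m) F)
    (v : cells cx 0) :
    g (cellAug F cx r (bas F m v)) = monomial (r v.1) 1 * g 1 := by
  classical
  have : cellAug F cx r (bas F m v) = monomial (r v.1) 1 := by
    simp only [cellAug, LinearMap.sum_apply, LinearMap.smul_apply,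
      LinearMap.proj_apply, smul_eq_mul, bas]
    rw [Finset.sum_eq_single v]
    · have h0 : cx.dim v.1 = 0 := v.2
      simp [cx.incEmpty_eq, h0]
    · intro b _ hb
      simp [hb]
    · simp
  rw [this, ← smul_eq_mul, ← map_smul]
  simp

lemma cdiff_apply (Y : Set cx.ι) (i : ℕ) (c : cellsIn cx Y i → F) (σ : cellsIn cx Y (i + 1)) :
    cdiff F cx Y i c σ = ∑ τ : cellsIn cx Y i, ((cx.inc σ.1 τ.1 : ℤ) : F) * c τ := by
  simp [cdiff, LinearMap.sum_apply]

lemma strand_diff (hmono : ∀ σ τ : cx.ι, cx.cell τ ⊆ closure (cx.cell σ) → r τ ≤ r σ)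
    (a : Fin m → ℤ) (i : ℕ) (g : Dual F m cx i) :
    strand r a (i + 1) (g ∘ₗ cellDiff F cx r i) = cdiff F cx (above r a) i (strand r a i g) := by
  classical
  ext σ
  rw [cdiff_apply]
  have hσ : ∀ j, a j ≤ (r σ.1 j : ℤ) := σ.2.1
  refine (congrArg (coeff (expo r a σ.1)) (cellDiff_bas r i g (toCell σ))).trans ?_
  rw [coeff_sum]
  symm
  have hterm : ∀ τ : cells cx i, coeff (expo r a σ.1)
      (monomial (r (toCell σ).1 - r τ.1) ((cx.inc (toCell σ).1 τ.1 : ℤ) : F) * g (bas F m τ)) =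
      if τ.1 ∈ above r a then ((cx.inc σ.1 τ.1 : ℤ) : F) * coeff (expo r a τ.1) (g (bas F m τ))
      else 0 := by
    intro τ
    rw [toCell_val]
    by_cases hinc : cx.inc σ.1 τ.1 = 0
    · simp [hinc]
    have hle := hmono _ _ ((cx.inc_ne_zero_iff _ _).mp hinc).2
    rw [coeff_monomial_mul']
    have hiff : r σ.1 - r τ.1 ≤ expo r a σ.1 ↔ τ.1 ∈ above r a := by
      constructor
      · intro h j
        have h1 := h j
        have h2 := hσ j
        have h3 := hle j
        simp only [expo_apply, Finsupp.tsub_apply] at h1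
        omega
      · intro h j
        have h1 : a j ≤ (r τ.1 j : ℤ) := h j
        have h2 := hσ j
        have h3 := hle j
        simp only [expo_apply, Finsupp.tsub_apply]
        omega
    rw [if_congr hiff rfl rfl]
    split_ifs with h
    · congr 2
      ext j
      have h1 : a j ≤ (r τ.1 j : ℤ) := h j
      have h2 := hσ j
      have h3 := hle j
      simp only [expo_apply, Finsupp.tsub_apply]
      omega
    · rfl
  refine Finset.sum_of_injOn (fun τ : cellsIn cx (above r a) i => toCell τ)
    ?_ ?_ ?_ ?_
  · intro x _ y _ hxy
    exact Subtype.ext (congrArg (fun z : cells cx i => z.1) hxy)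
  · intro x _; simp
  · intro τ _ hτ
    rw [hterm, if_neg]
    intro h
    exact hτ ⟨ofCell τ h, by simp, rfl⟩
  · intro τ _
    have h : (toCell τ).1 ∈ above r a := τ.2.1
    rw [hterm, if_pos h]
    rfl

/-- strand of the ring itself -/
noncomputable def strand0 (a : Fin m → ℤ) :
    (MvPolynomial (Fin m) F →ₗ[MvPolynomial (Fin m) F] MvPolynomial (Fin m) F) →+ F where
  toFun f := if ∀ j, a j ≤ 0 then
    coeff (Finsupp.equivFunOnFinite.symm (fun j => (-a j).toNat)) (f 1) else 0
  map_zero' := by simp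
  map_add' f g := by split_ifs <;> simp

lemma strand0_apply (a : Fin m → ℤ)
    (f : MvPolynomial (Fin m) F →ₗ[MvPolynomial (Fin m) F] MvPolynomial (Fin m) F) :
    strand0 a f = if ∀ j, a j ≤ 0 then
      coeff (Finsupp.equivFunOnFinite.symm (fun j => (-a j).toNat)) (f 1) else 0 := rfl

/-- lift from the strand of the ring -/
noncomputable def slift0 (a : Fin m → ℤ) (c : F) :
    (MvPolynomial (Fin m) F →ₗ[MvPolynomial (Fin m) F] MvPolynomial (Fin m) F) :=
  LinearMap.toSpanSingleton _ _ (if ∀ j, a j ≤ 0 then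
    monomial (Finsupp.equivFunOnFinite.symm (fun j => (-a j).toNat)) c else 0)

lemma strand_aug (a : Fin m → ℤ)
    (g : MvPolynomial (Fin m) F →ₗ[MvPolynomial (Fin m) F] MvPolynomial (Fin m) F) :
    strand r a 0 (g ∘ₗ cellAug F cx r) =
      caug F cx (above r a) (if ∀ j, a j ≤ 0 then true else false) (strand0 a g) := by
  classical
  ext σ
  have hσ : ∀ j, a j ≤ (r σ.1 j : ℤ) := σ.2.1
  have h0 : cx.dim σ.1 = 0 := σ.2.2
  refine (congrArg (coeff (expo r a σ.1)) (cellAug_bas r g (toCell σ))).trans ?_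
  rw [coeff_monomial_mul', toCell_val]
  have hiff : r σ.1 ≤ expo r a σ.1 ↔ ∀ j, a j ≤ 0 := by
    constructor
    · intro h j
      have h1 := h j
      have h2 := hσ j
      simp only [expo_apply] at h1
      omega
    · intro h j
      have h1 := h j
      simp only [expo_apply]
      omega
  rw [if_congr hiff rfl rfl, strand0_apply]
  split_ifs with h
  · simp only [caug, if_true, LinearMap.pi_apply, cx.incEmpty_eq, h0]
    have : expo r a σ.1 - r σ.1 = Finsupp.equivFunOnFinite.symm (fun j => (-a j).toNat) := by
      ext j
      have h1 := h j
      simp only [expo_apply, Finsupp.tsub_apply, Finsupp.equivFunOnFinite_symm_apply_apply]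
      omega
    rw [this]
    simp
  · simp [caug]

lemma combH_zero_iff (Y : Set cx.ι) (b : Bool) :
    Subsingleton (combH F cx Y b 0) ↔ ∀ c, cdiff F cx Y 0 c = 0 → ∃ e, caug F cx Y b e = c := by
  show Subsingleton ((LinearMap.ker (cdiff F cx Y 0)) ⧸
        (Submodule.comap (LinearMap.ker (cdiff F cx Y 0)).subtype
          (LinearMap.range (caug F cx Y b)))) ↔ _
  rw [Submodule.Quotient.subsingleton_iff, Submodule.comap_subtype_eq_top]
  rfl

lemma combH_succ_iff (Y : Set cx.ι) (b : Bool) (i : ℕ) :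
    Subsingleton (combH F cx Y b (i + 1)) ↔
      ∀ c, cdiff F cx Y (i + 1) c = 0 → ∃ e, cdiff F cx Y i e = c := by
  show Subsingleton ((LinearMap.ker (cdiff F cx Y (i + 1))) ⧸
        (Submodule.comap (LinearMap.ker (cdiff F cx Y (i + 1))).subtype
          (LinearMap.range (cdiff F cx Y i)))) ↔ _
  rw [Submodule.Quotient.subsingleton_iff, Submodule.comap_subtype_eq_top]
  rfl

/-- precomposition as an additive map -/
noncomputable abbrev precompAdd {R M N P : Type} [CommRing R] [AddCommGroup M] [AddCommGroup N] [AddCommGroup P]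
    [Module R M] [Module R N] [Module R P] (d : M →ₗ[R] N) : (N →ₗ[R] P) →+ (M →ₗ[R] P) where
  toFun g := g ∘ₗ d
  map_zero' := by simp
  map_add' f g := by rw [LinearMap.add_comp]

lemma dual_exact_succ (hmono : ∀ σ τ : cx.ι, cx.cell τ ⊆ closure (cx.cell σ) → r τ ≤ r σ)
    (i : ℕ) :
    (∀ f : Dual F m cx (i + 1), f ∘ₗ cellDiff F cx r (i + 1) = 0 →
      ∃ g : Dual F m cx i, f = g ∘ₗ cellDiff F cx r i) ↔
    ∀ a : Fin m → ℤ, Subsingleton (combH F cx {σ | ∀ j, a j ≤ (r σ j : ℤ)}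
          (if ∀ j, a j ≤ 0 then true else false) (i + 1)) := by
  simp_rw [combH_succ_iff]
  exact strand_exact (precompAdd (cellDiff F cx r i)) (precompAdd (cellDiff F cx r (i + 1)))
    (fun a => (cdiff F cx (above r a) i).toAddMonoidHom)
    (fun a => (cdiff F cx (above r a) (i + 1)).toAddMonoidHom)
    (fun a => strand r a i) (fun a => strand r a (i + 1)) (fun a => strand r a (i + 2))
    (fun a => slift r a i) (fun a => slift r a (i + 1))
    (fun a u => strand_diff r hmono a i u) (fun a u => strand_diff r hmono a (i + 1) u)
    (strand_sep r _) (strand_sep r _) (strand_fin r _) (fun a c => strand_slift r a _ c)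
    (fun a a' c h => strand_slift_ne r a a' h _ c)
    (fun a c => by rw [strand_slift])
    (fun a a' c h => strand_slift_ne r a a' h _ c)

lemma dual_exact_zero
    (hmono : ∀ σ τ : cx.ι, cx.cell τ ⊆ closure (cx.cell σ) → r τ ≤ r σ) :
    (∀ f : Dual F m cx 0, f ∘ₗ cellDiff F cx r 0 = 0 →
      ∃ g : MvPolynomial (Fin m) F →ₗ[MvPolynomial (Fin m) F] MvPolynomial (Fin m) F,
        f = g ∘ₗ cellAug F cx r) ↔
    ∀ a : Fin m → ℤ, Subsingleton (combH F cx {σ | ∀ j, a j ≤ (r σ j : ℤ)}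
          (if ∀ j, a j ≤ 0 then true else false) 0) := by
  simp_rw [combH_zero_iff]
  refine strand_exact (precompAdd (cellAug F cx r)) (precompAdd (cellDiff F cx r 0))
    (fun a => (caug F cx (above r a) (if ∀ j, a j ≤ 0 then true else false)).toAddMonoidHom)
    (fun a => (cdiff F cx (above r a) 0).toAddMonoidHom)
    (fun a => strand0 a) (fun a => strand r a 0) (fun a => strand r a 1)
    (fun a => slift0 a) (fun a => slift r a 0)
    (fun a u => strand_aug r a u) (fun a u => strand_diff r hmono a 0 u)
    (strand_sep r _) (strand_sep r _) (strand_fin r _) (fun a c => strand_slift r a _ c)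
    (fun a a' c h => strand_slift_ne r a a' h _ c)
    (fun a c => ?_)
    (fun a a' c h => ?_)
  · by_cases h : ∀ j, a j ≤ 0
    · congr 1
      rw [strand0_apply, if_pos h, slift0, if_pos h]
      simp
    · simp [h, caug]
  · rw [strand0_apply, slift0]
    split_ifs with h1 h2
    · rw [LinearMap.toSpanSingleton_apply, one_smul, coeff_monomial, if_neg]
      intro he
      apply h
      ext j
      have := DFunLike.congr_fun he j
      simp only [Finsupp.equivFunOnFinite_symm_apply_apply] at this
      have := h1 j
      have := h2 j
      omega
    · simp
    · rfl

end StrandPart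

section DepthPart

open Abelian RingTheory.Sequence

variable {F : Type} [Field F]

lemma depth_key {t q : ℕ} (A : ℕ → ModuleCat.{0} (MvPolynomial (Fin (t + 1)) F))
    (δ : ∀ i, A (i + 1) →ₗ[MvPolynomial (Fin (t + 1)) F] A i)
    (hex : ∀ i, LinearMap.ker (δ i) = LinearMap.range (δ (i + 1)))
    (hv : ∀ j i, i < t + 1 → Subsingleton (Ext (resK F (t + 1)) (A (j + 1)) i))
    (hinj : Function.Injective (δ (q + 1)))
    (hsm : δ (q + 1) ∈ irrel F (t + 1) • (⊤ : Submodule (MvPolynomial (Fin (t + 1)) F)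
      (A (q + 2) →ₗ[MvPolynomial (Fin (t + 1)) F] A (q + 1))))
    (hne : ¬ Subsingleton (Ext (resK F (t + 1)) (A (q + 2)) (t + 1))) :
    q ≤ t ∧ ¬ Subsingleton (Ext (resK F (t + 1)) (syz A δ 0) (t - q)) ∧
      ∀ i, i < t - q → Subsingleton (Ext (resK F (t + 1)) (syz A δ 0) i) := by
  let e : A (q + 2) ≃ₗ[MvPolynomial (Fin (t + 1)) F] LinearMap.range (δ (q + 1)) :=
    LinearEquiv.ofInjective (δ (q + 1)) hinj
  let e1 : A (q + 2) ⟶ syz A δ (q + 1) := ModuleCat.ofHom e.toLinearMap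
  let e2 : syz A δ (q + 1) ⟶ A (q + 2) := ModuleCat.ofHom e.symm.toLinearMap
  have he12 : e1 ≫ e2 = 𝟙 _ := by
    ext x
    exact e.symm_apply_apply x
  have he21 : e2 ≫ e1 = 𝟙 _ := by
    ext x
    exact congrArg Subtype.val (e.apply_symm_apply x)
  have hsub : (ModuleCat.ofHom (LinearMap.range (δ (q + 1))).subtype : syz A δ (q + 1) ⟶ A (q + 1))
      = e2 ≫ ModuleCat.ofHom (δ (q + 1)) := by
    ext x
    have : e (e.symm x) = x := e.apply_symm_apply x
    exact (congrArg Subtype.val this).symm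
  have hvan : ∀ s i j, i + s < t + 1 → j + s = q + 1 →
      Subsingleton (Ext (resK F (t + 1)) (syz A δ j) i) := by
    intro s
    induction s with
    | zero =>
      intro i j hi hj
      obtain rfl : j = q + 1 := by omega
      exact ext_subsingleton_of_retract _ e2 e1 he21 i (hv _ _ (by omega))
    | succ s ih =>
      intro i j hi hj
      exact ext_syz_van hex _ j i (hv _ _ (by omega)) (ih (i + 1) (j + 1) (by omega) (by omega))
  have hann : irrel F (t + 1) ≤ Module.annihilator (MvPolynomial (Fin (t + 1)) F)
      (resK F (t + 1)) := by
    have := Ideal.annihilator_quotient (I := irrel F (t + 1))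
    exact this.ge
  have hnev : ∀ s i j, i + s = t → j + s = q →
      ¬ Subsingleton (Ext (resK F (t + 1)) (syz A δ j) i) := by
    intro s
    induction s with
    | zero =>
      intro i j hi hj h
      obtain rfl : j = q := by omega
      obtain rfl : i = t := by omega
      apply hne
      refine ext_subsingleton_of_retract _ e1 e2 he12 _ ⟨fun x y => ?_⟩
      rw [← sub_eq_zero]
      have hS := rangeSC_shortExact (δ (j + 1)) (δ j) (hex j)
      obtain ⟨z, hz⟩ := Ext.covariant_sequence_exact₁ (resK F (i + 1)) hS (x - y) (n₀ := i) (by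
        show (x - y).comp (Ext.mk₀ (ModuleCat.ofHom (LinearMap.range (δ (j + 1))).subtype)) _ = 0
        rw [hsub, ← Ext.mk₀_comp_mk₀, ← Ext.comp_assoc_of_third_deg_zero]
        exact ext_comp_mem_smul_top _ _ hann _ hsm _ _) rfl
      rw [← hz, show z = 0 from h.elim _ _]
      simp
    | succ s ih =>
      intro i j hi hj h
      exact ih (i + 1) (j + 1) (by omega) (by omega)
        (ext_syz_ne hex _ j i (hv _ _ (by omega)) h)
  have hqt : q ≤ t := by
    by_contra hlt
    refine hnev t 0 (q - t) (by omega) (by omega) ?_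
    obtain ⟨j, hj⟩ : ∃ j, q - t = j + 1 := ⟨q - t - 1, by omega⟩
    rw [hj]
    apply ext_zero_subsingleton
    have h0 : Subsingleton (resK F (t + 1) →ₗ[MvPolynomial (Fin (t + 1)) F] A (j + 1)) :=
      (Ext.addEquiv₀.trans ModuleCat.homAddEquiv).subsingleton_congr.mp (hv j 0 (by omega))
    refine ⟨fun f g => ?_⟩
    have := h0.elim ((LinearMap.range (δ (j + 1))).subtype ∘ₗ f)
      ((LinearMap.range (δ (j + 1))).subtype ∘ₗ g)
    exact LinearMap.ext fun x => Subtype.ext (LinearMap.congr_fun this x)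
  exact ⟨hqt, hnev q _ _ (by omega) (by omega), fun i hi => hvan (q + 1) i 0 (by omega) (by omega)⟩

end DepthPart
section CellPart

open Abelian RingTheory.Sequence

variable {F : Type} [Field F] {m : ℕ} {Xs : Type} [TopologicalSpace Xs] (cx : FinRegCWI Xs)
  (r : cx.ι → (Fin m →₀ ℕ)) (J : Ideal (MvPolynomial (Fin m) F))

/-- the augmented cellular resolution, modules -/
noncomputable def cA : ℕ → ModuleCat.{0} (MvPolynomial (Fin m) F)
  | 0 => ModuleCat.of _ (MvPolynomial (Fin m) F ⧸ J)
  | 1 => ModuleCat.of _ (MvPolynomial (Fin m) F)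
  | i + 2 => ModuleCat.of _ (cells cx i → MvPolynomial (Fin m) F)

/-- the augmented cellular resolution, maps -/
noncomputable def cδ : ∀ i, cA cx J (i + 1) →ₗ[MvPolynomial (Fin m) F] cA cx J i
  | 0 => J.mkQ
  | 1 => cellAug F cx r
  | i + 2 => cellDiff F cx r i

variable {cx r J}

lemma cδ_exact (h : IsCellularResolution F cx r J) (i : ℕ) :
    LinearMap.ker (cδ cx r J i) = LinearMap.range (cδ cx r J (i + 1)) := by
  match i with
  | 0 => exact (Submodule.ker_mkQ J).trans h.1.symm
  | 1 => exact h.2.1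
  | i + 2 => exact h.2.2 i

lemma cA_proj (i : ℕ) : Projective (cA cx J (i + 1)) := by
  match i with
  | 0 => exact (IsProjective.iff_projective (R := MvPolynomial (Fin m) F) (MvPolynomial (Fin m) F)).mp inferInstance
  | i + 1 => exact (IsProjective.iff_projective (R := MvPolynomial (Fin m) F) (cells cx i → MvPolynomial (Fin m) F)).mp inferInstance

lemma cA_vanish (j i : ℕ) (hi : i < m) : Subsingleton (Ext (resK F m) (cA cx J (j + 1)) i) := by
  match j with
  | 0 => exact ext_resK_vanish i hi
  | j + 1 => exact ext_pi_subsingleton _ (cells cx j) i (ext_resK_vanish i hi)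

/-- `S/J ≅` zeroth syzygy -/
noncomputable def toSyz : ModuleCat.of (MvPolynomial (Fin m) F) (MvPolynomial (Fin m) F ⧸ J) ⟶
    syz (cA cx J) (cδ cx r J) 0 :=
  ModuleCat.ofHom (LinearMap.codRestrict _ LinearMap.id
    (fun x => LinearMap.mem_range.mpr (Submodule.mkQ_surjective J x)))

/-- zeroth syzygy `≅ S/J` -/
noncomputable def fromSyz : syz (cA cx J) (cδ cx r J) 0 ⟶
    ModuleCat.of (MvPolynomial (Fin m) F) (MvPolynomial (Fin m) F ⧸ J) :=
  ModuleCat.ofHom (LinearMap.range (cδ cx r J 0)).subtype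

lemma to_from : (toSyz (cx := cx) (r := r) (J := J)) ≫ fromSyz = 𝟙 (ModuleCat.of (MvPolynomial (Fin m) F)
    (MvPolynomial (Fin m) F ⧸ J)) := by
  rfl

lemma from_to : (fromSyz ≫ toSyz : syz (cA cx J) (cδ cx r J) 0 ⟶ _) = 𝟙 _ := by
  rfl

lemma syz_ext_left (N : ModuleCat.{0} (MvPolynomial (Fin m) F)) (i : ℕ) :
    Subsingleton (Ext (syz (cA cx J) (cδ cx r J) 0) N i) ↔
    Subsingleton (Ext (ModuleCat.of (MvPolynomial (Fin m) F) (MvPolynomial (Fin m) F ⧸ J)) N i) :=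
  ⟨ext_subsingleton_of_retract' N toSyz fromSyz to_from i,
    ext_subsingleton_of_retract' N fromSyz toSyz from_to i⟩

lemma syz_ext_right (N : ModuleCat.{0} (MvPolynomial (Fin m) F)) (i : ℕ) :
    Subsingleton (Ext N (syz (cA cx J) (cδ cx r J) 0) i) ↔
    Subsingleton (Ext N (ModuleCat.of (MvPolynomial (Fin m) F) (MvPolynomial (Fin m) F ⧸ J)) i) :=
  ⟨ext_subsingleton_of_retract N toSyz fromSyz to_from i,
    ext_subsingleton_of_retract N fromSyz toSyz from_to i⟩

lemma ext_iff_comb (h : IsCellularResolution F cx r J) (hmin : IsMinimalCellular cx r) (i : ℕ) :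
    Subsingleton (Ext (ModuleCat.of (MvPolynomial (Fin m) F) (MvPolynomial (Fin m) F ⧸ J))
      (ModuleCat.of (MvPolynomial (Fin m) F) (MvPolynomial (Fin m) F)) (i + 1)) ↔
    ∀ a : Fin m → ℤ, Subsingleton (combH F cx {σ | ∀ j, a j ≤ (r σ j : ℤ)}
          (if ∀ j, a j ≤ 0 then true else false) i) := by
  rw [← syz_ext_left (cx := cx) (r := r), ext_syz (cδ_exact h) cA_proj]
  match i with
  | 0 => exact dual_exact_zero r hmin.2.2
  | i + 1 => exact dual_exact_succ r hmin.2.2 i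

lemma cellDiff_entry (hmin : IsMinimalCellular cx r) (σ τ : cx.ι) :
    monomial (r σ - r τ) ((cx.inc σ τ : ℤ) : F) ∈ irrel F m := by
  by_cases hinc : cx.inc σ τ = 0
  · simp [hinc]
  · refine monomial_mem_irrel _ (fun h => hmin.1 σ τ hinc (le_antisymm ?_ ?_)) _
    · exact tsub_eq_zero_iff_le.mp h
    · exact hmin.2.2 _ _ ((cx.inc_ne_zero_iff _ _).mp hinc).2

lemma cellDiff_mem (hmin : IsMinimalCellular cx r) (i : ℕ) :
    cellDiff F cx r i ∈ irrel F m • (⊤ : Submodule (MvPolynomial (Fin m) F)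
      ((cells cx (i + 1) → MvPolynomial (Fin m) F) →ₗ[MvPolynomial (Fin m) F]
        (cells cx i → MvPolynomial (Fin m) F))) := by
  classical
  have : cellDiff F cx r i = ∑ τ : cells cx i, ∑ σ : cells cx (i + 1),
      (monomial (r σ.1 - r τ.1) ((cx.inc σ.1 τ.1 : ℤ) : F)) •
        (LinearMap.single (MvPolynomial (Fin m) F) (fun _ : cells cx i => MvPolynomial (Fin m) F) τ
          ∘ₗ LinearMap.proj σ) := by
    refine LinearMap.ext fun f => funext fun τ => ?_
    simp only [LinearMap.sum_apply, Finset.sum_apply, LinearMap.smul_apply, Pi.smul_apply,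
      LinearMap.comp_apply, LinearMap.single_apply, LinearMap.proj_apply]
    rw [Finset.sum_eq_single τ]
    · simp [cellDiff]
    · intro b _ hb
      simp [hb.symm]
    · simp
  rw [this]
  exact Submodule.sum_mem _ fun τ _ => Submodule.sum_mem _ fun σ _ =>
    Submodule.smul_mem_smul (cellDiff_entry hmin _ _) trivial

lemma cellAug_mem (hmin : IsMinimalCellular cx r) :
    cellAug F cx r ∈ irrel F m • (⊤ : Submodule (MvPolynomial (Fin m) F)
      ((cells cx 0 → MvPolynomial (Fin m) F) →ₗ[MvPolynomial (Fin m) F]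
        MvPolynomial (Fin m) F)) :=
  Submodule.sum_mem _ fun v _ =>
    Submodule.smul_mem_smul (monomial_mem_irrel _ (hmin.2.1 v.1) _) trivial

lemma cδ_mem (hmin : IsMinimalCellular cx r) (i : ℕ) :
    cδ cx r J (i + 1) ∈ irrel F m • (⊤ : Submodule (MvPolynomial (Fin m) F)
      (cA cx J (i + 2) →ₗ[MvPolynomial (Fin m) F] cA cx J (i + 1))) := by
  match i with
  | 0 => exact cellAug_mem hmin
  | i + 1 => exact cellDiff_mem hmin i

lemma range_cellAug_le (P : Ideal (MvPolynomial (Fin m) F))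
    (hP : ∀ (v : cells cx 0) (c : F), monomial (r v.1) c ∈ P) :
    LinearMap.range (cellAug F cx r) ≤ P := by
  rintro _ ⟨f, rfl⟩
  simp only [cellAug, LinearMap.sum_apply, LinearMap.smul_apply, LinearMap.proj_apply, smul_eq_mul]
  exact Ideal.sum_mem _ fun v _ => Ideal.mul_mem_right _ _ (hP v _)

lemma cells_empty_succ (h : IsCellularResolution F cx r J) (hmin : IsMinimalCellular cx r) (i : ℕ)
    (he : IsEmpty (cells cx i)) : IsEmpty (cells cx (i + 1)) := by
  classical
  refine ⟨fun σ => irrel_ne_top (F := F) (m := m) ?_⟩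
  have hk : bas F m σ ∈ LinearMap.ker (cellDiff F cx r i) := Subsingleton.elim _ _
  rw [h.2.2 i] at hk
  obtain ⟨f, hf⟩ := hk
  have h1 : cellDiff F cx r (i + 1) f σ = 1 := by
    rw [hf]; simp [bas]
  rw [Ideal.eq_top_iff_one, ← h1]
  simp only [cellDiff, LinearMap.pi_apply, LinearMap.sum_apply, LinearMap.smul_apply,
    LinearMap.proj_apply, smul_eq_mul]
  exact Ideal.sum_mem _ fun v _ => Ideal.mul_mem_right _ _ (cellDiff_entry hmin _ _)

lemma exists_vertex (h : IsCellularResolution F cx r J) (hmin : IsMinimalCellular cx r)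
    (τ : cx.ι) : Nonempty (cells cx 0) := by
  by_contra hne
  have h0 : IsEmpty (cells cx 0) := not_nonempty_iff.mp hne
  have : ∀ i, IsEmpty (cells cx i) := fun i => by
    induction i with
    | zero => exact h0
    | succ i ih => exact cells_empty_succ h hmin i ih
  exact (this (cx.dim τ)).false ⟨τ, rfl⟩

lemma monomial_mem (h : IsCellularResolution F cx r J) (v : cells cx 0) : monomial (r v.1) 1 ∈ J := by
  have h1 := cellAug_bas (F := F) r LinearMap.id v
  rw [← h.1]
  exact ⟨bas F m v, by simpa using h1⟩

lemma ext_zero_quot (x : MvPolynomial (Fin m) F) (hx : x ∈ J) (h0 : x ≠ 0) :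
    Subsingleton (Ext (ModuleCat.of (MvPolynomial (Fin m) F) (MvPolynomial (Fin m) F ⧸ J))
      (ModuleCat.of (MvPolynomial (Fin m) F) (MvPolynomial (Fin m) F)) 0) := by
  apply ext_zero_subsingleton
  have key : ∀ f : (MvPolynomial (Fin m) F ⧸ J) →ₗ[MvPolynomial (Fin m) F] MvPolynomial (Fin m) F,
      f = 0 := by
    intro f
    refine LinearMap.ext fun y => ?_
    have h1 : x • y = 0 := by
      obtain ⟨y, rfl⟩ := Ideal.Quotient.mk_surjective y
      have : x • (Ideal.Quotient.mk J y) = Ideal.Quotient.mk J (x * y) := rfl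
      rw [this, Ideal.Quotient.eq_zero_iff_mem]
      exact Ideal.mul_mem_right _ _ hx
    have h2 : x * f y = 0 := by rw [← smul_eq_mul, ← map_smul, h1, map_zero]
    exact (mul_eq_zero.mp h2).resolve_left h0
  exact ⟨fun f g => (key f).trans (key g).symm⟩

lemma prime_vars (h : IsCellularResolution F cx r J) (Q : Ideal (MvPolynomial (Fin m) F))
    (hQ : Q.IsPrime) (hJ : J ≤ Q) (V : Finset (Fin m))
    (hV : ∀ v, (X v : MvPolynomial (Fin m) F) ∈ Q → v ∈ V) :
    J ≤ Ideal.span (X '' (V : Set (Fin m))) := by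
  rw [← h.1]
  refine range_cellAug_le _ fun v c => ?_
  have h1 := hJ (monomial_mem h v)
  rw [monomial_eq, map_one, one_mul, Finsupp.prod, hQ.prod_mem_iff] at h1
  obtain ⟨j, hj, hjQ⟩ := h1
  have h2 := hQ.mem_of_pow_mem _ hjQ
  rw [mem_ideal_span_X_image]
  intro e' he'
  have := Finset.mem_singleton.mp (support_monomial_subset he')
  subst this
  exact ⟨j, hV j h2, Finsupp.mem_support_iff.mp hj⟩

lemma combH_empty (i : ℕ) (he : IsEmpty (cells cx i)) (Y : Set cx.ι) (b : Bool) :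
    Subsingleton (combH F cx Y b i) := by
  have : IsEmpty (cellsIn cx Y i) := ⟨fun τ => he.false (toCell τ)⟩
  match i with
  | 0 => exact (combH_zero_iff Y b).mpr fun c _ => ⟨0, Subsingleton.elim _ _⟩
  | i + 1 => exact (combH_succ_iff Y b i).mpr fun c _ => ⟨0, Subsingleton.elim _ _⟩

lemma cells_depth {t : ℕ} {r : cx.ι → (Fin (t + 1) →₀ ℕ)}
    {J : Ideal (MvPolynomial (Fin (t + 1)) F)} (h : IsCellularResolution F cx r J)
    (hmin : IsMinimalCellular cx r) (d : ℕ) (hd : Nonempty (cells cx d))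
    (hd1 : IsEmpty (cells cx (d + 1))) :
    d ≤ t ∧ ¬ Subsingleton (Ext (resK F (t + 1)) (ModuleCat.of (MvPolynomial (Fin (t + 1)) F)
        (MvPolynomial (Fin (t + 1)) F ⧸ J)) (t - d)) ∧
      ∀ i, i < t - d → Subsingleton (Ext (resK F (t + 1))
        (ModuleCat.of (MvPolynomial (Fin (t + 1)) F) (MvPolynomial (Fin (t + 1)) F ⧸ J)) i) := by
  classical
  have := depth_key (q := d) (cA cx J) (cδ cx r J) (cδ_exact h) (fun j i hi => cA_vanish j i hi) (by
      rw [← LinearMap.ker_eq_bot, cδ_exact h, eq_bot_iff]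
      rintro _ ⟨x, rfl⟩
      have : x = 0 := by
        refine funext (fun σ : cells cx (d + 1) => (hd1.false σ).elim)
      rw [this]
      simp) (cδ_mem hmin d) (by
      intro hs
      apply ext_resK_ne (F := F) (m := t + 1)
      let σ := hd.some
      refine ext_subsingleton_of_retract _ (N := cA cx J (d + 2))
        (ModuleCat.ofHom (LinearMap.single (MvPolynomial (Fin (t + 1)) F)
          (fun _ : cells cx d => MvPolynomial (Fin (t + 1)) F) σ))
        (ModuleCat.ofHom (LinearMap.proj (R := MvPolynomial (Fin (t + 1)) F)
          (φ := fun _ : cells cx d => MvPolynomial (Fin (t + 1)) F) σ)) ?_ _ hs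
      ext
      exact congrArg (coeff _) <| Pi.single_eq_same (M := fun _ : cells cx d => MvPolynomial (Fin (t + 1)) F) σ 1)
  simpa only [syz_ext_right] using this

end CellPart

/-- for a monomial ideal `I` with a minimal cellular resolution supported
on a finite regular CW complex `X`, `S/I` is Cohen–Macaulay iff
`H^i(C^•(X^{≥a})) = 0` for all `a ∈ ℤⁿ` and all `i ≠ dim X`. -/
theorem cm_iff_cochain_vanishing
    (Xsp : Type) [TopologicalSpace Xsp] (cw : FinRegCWI Xsp)
    (ρ : cw.ι → (Fin n →₀ ℕ)) (I : Ideal (MvPolynomial (Fin n) k))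
    (hres : IsCellularResolution k cw ρ I)
    (hmin : IsMinimalCellular cw ρ)
    (d : ℕ) (hd : (∀ τ : cw.ι, cw.dim τ ≤ d) ∧ (∃ τ : cw.ι, cw.dim τ = d)) :
    IsCMQuotient k I ↔
      ∀ a : Fin n → ℤ, ∀ i : ℕ, i ≠ d →
        Subsingleton (combH k cw {σ | ∀ j, a j ≤ (ρ σ j : ℤ)}
          (if ∀ j, a j ≤ 0 then true else false) i) := by
  classical
  obtain ⟨τ, hτ⟩ := hd.2
  obtain ⟨v0⟩ := exists_vertex hres hmin τ
  match n with
  | 0 => exact absurd (Subsingleton.elim _ _) (hmin.2.1 τ)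
  | t + 1 =>
  have hempty : ∀ i, d < i → IsEmpty (cells cw i) := fun i hi => ⟨fun σ => by
    have h1 := hd.1 σ.1
    have h2 : cw.dim σ.1 = i := σ.2
    omega⟩
  obtain ⟨hdt, hne, hvan⟩ := cells_depth hres hmin d ⟨⟨τ, hτ⟩⟩ (hempty _ (by omega))
  have hI : I ≤ irrel k (t + 1) := by
    rw [← hres.1]
    exact range_cellAug_le _ fun v c => monomial_mem_irrel _ (hmin.2.1 v.1) c
  have h0 : Subsingleton (Abelian.Ext (ModuleCat.of (MvPolynomial (Fin (t + 1)) k)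
      (MvPolynomial (Fin (t + 1)) k ⧸ I))
      (ModuleCat.of (MvPolynomial (Fin (t + 1)) k) (MvPolynomial (Fin (t + 1)) k)) 0) :=
    ext_zero_quot _ (monomial_mem hres v0) (by simp)
  constructor
  · rintro ⟨rs, hrs, hreg, hdim⟩ a i hid
    rcases lt_or_gt_of_ne hid with hlt | hgt
    swap
    · exact combH_empty i (hempty i hgt) _ _
    have hlen : rs.length ≤ t - d := by
      by_contra hl
      exact hne (ModuleCat.subsingleton_ext_of_exists_isRegular (irrel k (t + 1))
        (resK k (t + 1)) (support_quot _).subset (ModuleCat.of _ (MvPolynomial (Fin (t + 1)) k ⧸ I))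
        (irrel_smul_quot_lt I hI) rs hrs hreg _ (by omega))
    refine (ext_iff_comb hres hmin i).mp (ext_grade (d + 1) I ?_ _ (by omega)) a
    intro Q hQ hIQ
    refine ⟨Finset.univ.filter fun v => (X v : MvPolynomial (Fin (t + 1)) k) ∈ Q, ?_, by simp⟩
    have h1 := dim_quot_ge I _ (prime_vars hres Q hQ hIQ
      (Finset.univ.filter fun v => (X v : MvPolynomial (Fin (t + 1)) k) ∈ Q) (by simp))
    rw [hdim] at h1
    have h2 : t + 1 - (Finset.univ.filter fun v => (X v : MvPolynomial (Fin (t + 1)) k) ∈ Q).card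
      ≤ rs.length := (Nat.cast_le (α := WithBot ℕ∞)).mp h1
    omega
  · intro hcomb
    obtain ⟨rs, hl, hmem, hreg⟩ := ModuleCat.exists_isRegular_of_exists_subsingleton_ext I (d + 1)
      (ModuleCat.of _ (MvPolynomial (Fin (t + 1)) k)) (smul_top_lt_of_le I hI)
      (ModuleCat.of _ (MvPolynomial (Fin (t + 1)) k ⧸ I)) (support_quot I) (by
        intro i hi
        match i with
        | 0 => exact h0
        | i + 1 => exact (ext_iff_comb hres hmin i).mpr fun a => hcomb a i (by omega))
    obtain ⟨rs', hl', hmem', hreg'⟩ := ModuleCat.exists_isRegular_of_exists_subsingleton_ext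
      (irrel k (t + 1)) (t - d) (ModuleCat.of _ (MvPolynomial (Fin (t + 1)) k ⧸ I))
      (irrel_smul_quot_lt I hI) (resK k (t + 1)) (support_quot _) hvan
    refine ⟨rs', hmem', hreg', le_antisymm ?_ ?_⟩
    · have h1 := supportDim_add_length_le (MvPolynomial (Fin (t + 1)) k) rs hreg.toIsWeaklyRegular
      rw [Module.supportDim_self_eq_ringKrullDim, ringKrullDim_poly, hl] at h1
      have hle : Ideal.ofList rs • (⊤ : Ideal (MvPolynomial (Fin (t + 1)) k)) ≤ I := by
        rw [smul_eq_mul, Ideal.mul_top, Ideal.ofList, Ideal.span_le]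
        exact hmem
      have h2 := Module.supportDim_le_of_surjective (Submodule.factor hle)
        (Submodule.factor_surjective hle)
      rw [Module.supportDim_quotient_eq_ringKrullDim] at h2
      have h3 : ringKrullDim (MvPolynomial (Fin (t + 1)) k ⧸ I) + ((d + 1 : ℕ) : WithBot ℕ∞) ≤
        ((t + 1 : ℕ) : WithBot ℕ∞) := (add_le_add_left h2 _).trans h1
      rw [hl']
      generalize ringKrullDim (MvPolynomial (Fin (t + 1)) k ⧸ I) = D at h3
      induction D using WithBot.recBotCoe with
      | bot => exact bot_le
      | coe D =>
        induction D using ENat.recTopCoe with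
        | top =>
          have h4 : (⊤ : ℕ∞) + ((d + 1 : ℕ) : ℕ∞) ≤ ((t + 1 : ℕ) : ℕ∞) := WithBot.coe_le_coe.mp h3
          rw [top_add] at h4
          exact absurd (top_le_iff.mp h4) (ENat.natCast_ne_top _)
        | coe D =>
          have h4 : D + (d + 1) ≤ t + 1 := by exact_mod_cast h3
          have h5 : D ≤ t - d := by omega
          exact (Nat.cast_le (α := WithBot ℕ∞)).mpr h5
    · have := length_le_supportDim (MvPolynomial (Fin (t + 1)) k ⧸ I) rs' hreg'
      rwa [Module.supportDim_quotient_eq_ringKrullDim] at this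
end
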